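/- For the junction dynamics f on ℝ^{n+m}, the trajectory (q^k)_{k∈ℕ} defined by q^0 = 0 and q^{k+1} = f(q^k) has at most linearly growing time increments: for every T ∈ ℕ there exists a constant c₂ such that sup_k |q^{k+T}_i − q^k_i| ≤ c₂·T for every coordinate i. -/

import Mathlib

/-- The junction dynamics on two circular roads of `n` and `m` sections crossing
at one junction.  Coordinates `1, …, n` form the priority road, `n+1, …, n+m`
the non-priority road; `ā_i = 1 - a_i` for `i ∉ {n, n+m}` and
`ā_n = ā_{n+m} = 1 - a_n - a_{n+m}`. -/
noncomputable def junctionF (n m : ℕ) (a : ℕ → ℝ) (q : ℕ → ℝ) : ℕ → ℝ :=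
  fun i =>
    if i = 1 then
      min (a n + (q n + q (n + m)) / 2) ((1 - a 1) + q 2)
    else if i = n then
      min ((1 - a n - a (n + m)) + q 1 + q (n + 1) - q (n + m)) (a (n - 1) + q (n - 1))
    else if i = n + 1 then
      min (a (n + m) + (q n + q (n + m)) / 2) ((1 - a (n + 1)) + q (n + 2))
    else if i = n + m then
      min ((1 - a n - a (n + m)) + q 1 + q (n + 1)
            - min ((1 - a n - a (n + m)) + q 1 + q (n + 1) - q (n + m))
                (a (n - 1) + q (n - 1)))
          (a (n + m - 1) + q (n + m - 1))
    else
      min (a (i - 1) + q (i - 1)) ((1 - a i) + q (i + 1))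

/-- The states whose section and junction occupancies are admissible: no section holds a negative
number of cars or more cars than its capacity. -/
structure JunctionFeasible (n m : ℕ) (a q : ℕ → ℝ) : Prop where
  le_prev : ∀ i, 1 ≤ i → i < n + m → i ≠ n → q (i + 1) ≤ a i + q i
  le_next : ∀ i, 1 ≤ i → i < n + m → i ≠ n → q i ≤ 1 - a i + q (i + 1)
  le_exit_one : q 1 ≤ a n + (q n + q (n + m)) / 2
  le_exit_two : q (n + 1) ≤ a (n + m) + (q n + q (n + m)) / 2
  junction_le : q n + q (n + m) ≤ 1 - a n - a (n + m) + q 1 + q (n + 1)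

section Coordinates

variable {n m : ℕ} (a q : ℕ → ℝ)

theorem junctionF_one : junctionF n m a q 1 =
    min (a n + (q n + q (n + m)) / 2) (1 - a 1 + q 2) := by
  simp [junctionF]

theorem junctionF_priority (hn : 3 ≤ n) : junctionF n m a q n =
    min (1 - a n - a (n + m) + q 1 + q (n + 1) - q (n + m)) (a (n - 1) + q (n - 1)) := by
  have h : n ≠ 1 := by omega
  simp [junctionF, h]

theorem junctionF_succ (hn : 3 ≤ n) : junctionF n m a q (n + 1) =
    min (a (n + m) + (q n + q (n + m)) / 2) (1 - a (n + 1) + q (n + 2)) := by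
  have h : n ≠ 0 := by omega
  simp [junctionF, h]

theorem junctionF_add (hn : 3 ≤ n) (hm : 3 ≤ m) : junctionF n m a q (n + m) =
    min (1 - a n - a (n + m) + q 1 + q (n + 1) - junctionF n m a q n)
      (a (n + m - 1) + q (n + m - 1)) := by
  have h1 : n + m ≠ 1 := by omega
  have h2 : m ≠ 0 := by omega
  have h3 : m ≠ 1 := by omega
  rw [junctionF_priority a q hn]
  simp [junctionF, h1, h2, h3]

theorem junctionF_interior {i : ℕ} (h1 : i ≠ 1) (h2 : i ≠ n) (h3 : i ≠ n + 1) (h4 : i ≠ n + m) :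
    junctionF n m a q i = min (a (i - 1) + q (i - 1)) (1 - a i + q (i + 1)) := by
  simp [junctionF, h1, h2, h3, h4]

theorem junctionF_succ_le (hn : 3 ≤ n) (hm : 3 ≤ m) {i : ℕ} (h1 : 1 ≤ i) (h2 : i ≠ n) :
    junctionF n m a q (i + 1) ≤ a i + q i := by
  by_cases hin : i + 1 = n
  · have hi : n - 1 = i := by omega
    rw [hin, junctionF_priority a q hn, hi]
    exact min_le_right _ _
  by_cases him : i + 1 = n + m
  · have hi : n + m - 1 = i := by omega
    rw [him, junctionF_add a q hn hm, hi]
    exact min_le_right _ _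
  rw [junctionF_interior a q (by omega) hin (by omega) him]
  exact min_le_left _ _

theorem junctionF_le_next (hn : 3 ≤ n) {i : ℕ} (h1 : i ≠ n) (h2 : i ≠ n + m) :
    junctionF n m a q i ≤ 1 - a i + q (i + 1) := by
  by_cases hi : i = 1
  · rw [hi, junctionF_one]
    exact min_le_right _ _
  by_cases hin : i = n + 1
  · rw [hin, junctionF_succ a q hn]
    exact min_le_right _ _
  rw [junctionF_interior a q hi h1 hin h2]
  exact min_le_right _ _

variable {a q}

theorem JunctionFeasible.le_junctionF (hn : 3 ≤ n) (hm : 3 ≤ m) (h : JunctionFeasible n m a q)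
    {i : ℕ} (h1 : 1 ≤ i) (h2 : i ≤ n + m) : q i ≤ junctionF n m a q i := by
  have hprev : i ≠ 1 → i ≠ n + 1 → q i ≤ a (i - 1) + q (i - 1) := by
    intro hi hin
    have := h.le_prev (i - 1) (by omega) (by omega) (by omega)
    rwa [Nat.sub_add_cancel h1] at this
  by_cases hi : i = 1
  · subst hi
    rw [junctionF_one]
    exact le_min h.le_exit_one (h.le_next 1 le_rfl (by omega) (by omega))
  by_cases hin : i = n
  · subst hin
    rw [junctionF_priority a q hn]
    exact le_min (by linarith [h.junction_le]) (hprev hi (by omega))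
  by_cases hin' : i = n + 1
  · subst hin'
    rw [junctionF_succ a q hn]
    exact le_min h.le_exit_two (h.le_next (n + 1) h1 (by omega) hin)
  by_cases him : i = n + m
  · subst him
    have hle := min_le_left (1 - a n - a (n + m) + q 1 + q (n + 1) - q (n + m))
      (a (n - 1) + q (n - 1))
    rw [← junctionF_priority a q hn] at hle
    rw [junctionF_add a q hn hm]
    exact le_min (by linarith) (hprev hi hin')
  rw [junctionF_interior a q hi hin hin' him]
  exact le_min (hprev hi hin') (h.le_next i h1 (by omega) hin)

theorem JunctionFeasible.junctionF_le_add_one (hn : 3 ≤ n) (hm : 3 ≤ m)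
    (h : JunctionFeasible n m a q) {i : ℕ} (h1 : 1 ≤ i) (h2 : i ≤ n + m) :
    junctionF n m a q i ≤ q i + 1 := by
  by_cases hi : i = n ∨ i = n + m
  · obtain ⟨j, rfl⟩ : ∃ j, i = j + 1 := ⟨i - 1, by omega⟩
    linarith [junctionF_succ_le a q hn hm (i := j) (by omega) (by omega),
      h.le_next j (by omega) (by omega) (by omega)]
  · linarith [junctionF_le_next a q hn (i := i) (m := m) (by omega) (by omega),
      h.le_prev i h1 (by omega) (by omega)]

theorem JunctionFeasible.map (hn : 3 ≤ n) (hm : 3 ≤ m) (h : JunctionFeasible n m a q) :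
    JunctionFeasible n m a (junctionF n m a q) := by
  have mono {i : ℕ} (h1 : 1 ≤ i) (h2 : i ≤ n + m) := h.le_junctionF hn hm h1 h2
  have hN := mono (i := n) (by omega) (by omega)
  have hNM := mono (i := n + m) (by omega) le_rfl
  refine ⟨fun i h1 h2 h3 => ?_, fun i h1 h2 h3 => ?_, ?_, ?_, ?_⟩
  · linarith [junctionF_succ_le a q hn hm h1 h3, mono h1 h2.le]
  · linarith [junctionF_le_next a q hn h3 h2.ne, mono (i := i + 1) (by omega) (by omega)]
  · have := min_le_left (a n + (q n + q (n + m)) / 2) (1 - a 1 + q 2)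
    rw [← junctionF_one] at this
    linarith
  · have := min_le_left (a (n + m) + (q n + q (n + m)) / 2) (1 - a (n + 1) + q (n + 2))
    rw [← junctionF_succ a q hn] at this
    linarith
  · have := min_le_left (1 - a n - a (n + m) + q 1 + q (n + 1) - junctionF n m a q n)
      (a (n + m - 1) + q (n + m - 1))
    rw [← junctionF_add a q hn hm] at this
    linarith [mono (i := 1) le_rfl (by omega), mono (i := n + 1) (by omega) (by omega)]

end Coordinates

/-- the junction trajectory starting from `0` has at most linearly
growing time increments. -/
theorem junction_traj_linear_increments (n m : ℕ) (hn : 3 ≤ n) (hm : 3 ≤ m)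
    (a : ℕ → ℝ) (ha : ∀ i, 1 ≤ i → i ≤ n + m → 0 ≤ a i ∧ a i ≤ 1)
    (hjunc : a n + a (n + m) ≤ 1)
    (q : ℕ → ℕ → ℝ) (hq0 : ∀ i, q 0 i = 0)
    (hq : ∀ k, q (k + 1) = junctionF n m a (q k)) :
    ∀ T : ℕ, ∃ c₂ : ℝ, ∀ (k : ℕ) (i : ℕ), 1 ≤ i → i ≤ n + m →
      |q (k + T) i - q k i| ≤ c₂ * T := by
  have feas : ∀ k, JunctionFeasible n m a (q k) := by
    intro k
    induction k with
    | zero =>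
      have hN := (ha n (by omega) (by omega)).1
      have hNM := (ha (n + m) (by omega) le_rfl).1
      refine ⟨fun i h1 h2 _ => ?_, fun i h1 h2 _ => ?_, ?_, ?_, ?_⟩ <;> simp only [hq0]
      · linarith [(ha i h1 h2.le).1]
      · linarith [(ha i h1 h2.le).2]
      all_goals linarith
    | succ k ih =>
      rw [hq k]
      exact ih.map hn hm
  intro T
  refine ⟨1, fun k i h1 h2 => ?_⟩
  have bounds : q k i ≤ q (k + T) i ∧ q (k + T) i ≤ q k i + T := by
    induction T with
    | zero => simp
    | succ T ih =>
      have lower := (feas (k + T)).le_junctionF hn hm h1 h2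
      have upper := (feas (k + T)).junctionF_le_add_one hn hm h1 h2
      rw [← hq (k + T)] at lower upper
      rw [← add_assoc]
      push_cast
      constructor <;> linarith
  rw [abs_of_nonneg (by linarith)]
  linarith
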